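/- Let r ≥ 2, h ≥ 1, b₁, b₂ ≥ 1 be integers and ε > 0, let m : ℕ → ℕ satisfy m(0) = 0 and m(n+1) ≥ m(n) + M(m(n))·h for all n ≥ 0, and let ñ ≥ 1 be an integer satisfying C·b₂·√(b₂/ñ) ≤ ε/(2·binom(r,2)). Let G be a (b₁,b₂)-colored 𝔯-partite graph on Ω. For n < ñ and φ ∈ Φ(m(n)) write G* := G/φ, and let δ be defined for G* from η, C and the bad colors with M = M(m(n)). Then for every I ∈ binom(𝔯,2): E_n E_{φ∈Φ(m(n))} E_{e∈Ω_I}[ δ(G*⟨e⟩) ] ≤ ε/(b₂ · binom(r,2)), where n is uniform on {0, …, ñ−1} and φ, e are random. -/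

import Mathlib

open Finset
open scoped BigOperators Classical

/-! ## Framework: colored partite graphs, complexes, partitionwise maps,
regularization, relative densities and regularity (Ishigami's setting). -/

/-- Partitionwise maps `Φ(h)`: `h` sample vertices in each of the `r` parts. -/
abbrev PMap {r : ℕ} (Ω : Fin r → Type) (h : ℕ) : Type := ∀ i : Fin r, Fin h → Ω i

/-- The product weight of a partitionwise map (each sample independent). -/
noncomputable def pmapWeight {r : ℕ} (Ω : Fin r → Type) [∀ i, Fintype (Ω i)]
    (w : ∀ i, Ω i → ℝ) {h : ℕ} (φ : PMap Ω h) : ℝ :=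
  ∏ i : Fin r, ∏ a : Fin h, w i (φ i a)

/-- Expectation over a random partitionwise map in `Φ(h)`. -/
noncomputable def EPhi {r : ℕ} (Ω : Fin r → Type) [∀ i, Fintype (Ω i)]
    (w : ∀ i, Ω i → ℝ) (h : ℕ) (f : PMap Ω h → ℝ) : ℝ :=
  ∑ φ : PMap Ω h, pmapWeight Ω w φ * f φ

/-- Conditional expectation over a random partitionwise map in `Φ(h)`. -/
noncomputable def EPhiCond {r : ℕ} (Ω : Fin r → Type) [∀ i, Fintype (Ω i)]
    (w : ∀ i, Ω i → ℝ) (h : ℕ) (A : PMap Ω h → Prop) (f : PMap Ω h → ℝ) : ℝ :=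
  (∑ φ : PMap Ω h, if A φ then pmapWeight Ω w φ * f φ else 0) /
  (∑ φ : PMap Ω h, if A φ then pmapWeight Ω w φ else 0)

/-- A colored `𝔯`-partite graph on vertex sets `Ω i`: color sets `C1 i` (for vertices,
i.e. index-`{i}` edges) and `C2 i j` (for index-`{i,j}` edges), together with coloring
maps, symmetric in the two endpoints. -/
structure CGraph {r : ℕ} (Ω : Fin r → Type) (K₁ K₂ : Type) where
  C1 : Fin r → Finset K₁
  C2 : Fin r → Fin r → Finset K₂
  vCol : ∀ i, Ω i → K₁
  eCol : ∀ i j, Ω i → Ω j → K₂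
  eSymm : ∀ i j x y, eCol i j x y = eCol j i y x
  c2Symm : ∀ i j, C2 i j = C2 j i
  vMem : ∀ i x, vCol i x ∈ C1 i
  eMem : ∀ i j x y, eCol i j x y ∈ C2 i j

/-- `G` is `(b₁,b₂)`-colored: each color set `C_I` has at most `b_{|I|}` elements. -/
def CGraph.Bounded {r : ℕ} {Ω : Fin r → Type} {K₁ K₂ : Type}
    (G : CGraph Ω K₁ K₂) (b₁ b₂ : ℕ) : Prop :=
  (∀ i, (G.C1 i).card ≤ b₁) ∧ ∀ i j, i ≠ j → (G.C2 i j).card ≤ b₂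

/-- Relative density `d_G(c)` of a vertex (index-`{i}`) total color `c`:
the probability that a random vertex of `Ω i` has color `c`. -/
noncomputable def dV {r : ℕ} (Ω : Fin r → Type) [∀ i, Fintype (Ω i)]
    (w : ∀ i, Ω i → ℝ) {K₁ K₂ : Type} (G : CGraph Ω K₁ K₂) (i : Fin r) (c : K₁) : ℝ :=
  ∑ x : Ω i, if G.vCol i x = c then w i x else 0

/-- Relative density `d_G(c₂; ci, cj)` of an index-`{i,j}` total color:
the conditional probability that a random edge has color `c₂` given that its
endpoints have colors `ci`, `cj`. -/
noncomputable def dE {r : ℕ} (Ω : Fin r → Type) [∀ i, Fintype (Ω i)]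
    (w : ∀ i, Ω i → ℝ) {K₁ K₂ : Type} (G : CGraph Ω K₁ K₂) (i j : Fin r)
    (c₂ : K₂) (ci cj : K₁) : ℝ :=
  (∑ x : Ω i, ∑ y : Ω j,
      if G.eCol i j x y = c₂ ∧ G.vCol i x = ci ∧ G.vCol j y = cj then w i x * w j y else 0) /
  (∑ x : Ω i, ∑ y : Ω j, if G.vCol i x = ci ∧ G.vCol j y = cj then w i x * w j y else 0)

/-- A (simplicial) complex with `h` vertices in each of the `r` parts: a colored
partite graph where `none` is the (unique) invisible color of each index, and any
edge containing an invisible vertex is invisible. -/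
structure SComplex (r h : ℕ) (K₁ K₂ : Type) where
  vCol : Fin r → Fin h → Option K₁
  eCol : Fin r → Fin r → Fin h → Fin h → Option K₂
  eSymm : ∀ i j a b, eCol i j a b = eCol j i b a
  loopless : ∀ i a b, eCol i i a b = none
  down : ∀ i j a b, vCol i a = none → eCol i j a b = none

/-- `S ∈ S_{h,G}` : the visible colors of the complex `S` are (identified with)
colors of `G`. -/
def SComplex.MemS {r h : ℕ} {Ω : Fin r → Type} {K₁ K₂ : Type}
    (S : SComplex r h K₁ K₂) (G : CGraph Ω K₁ K₂) : Prop :=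
  (∀ i a c, S.vCol i a = some c → c ∈ G.C1 i) ∧
  (∀ i j a b c, S.eCol i j a b = some c → c ∈ G.C2 i j)

/-- `𝕍₁(S)`: the visible vertices of `S`. -/
noncomputable def V1 {r h : ℕ} {K₁ K₂ : Type} (S : SComplex r h K₁ K₂) :
    Finset (Fin r × Fin h) :=
  univ.filter fun p => S.vCol p.1 p.2 ≠ none

/-- `𝕍₂(S)`: the visible (size-2) edges of `S`, listed once each (`i < j`). -/
noncomputable def V2 {r h : ℕ} {K₁ K₂ : Type} (S : SComplex r h K₁ K₂) :
    Finset (Fin r × Fin r × Fin h × Fin h) :=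
  univ.filter fun q => q.1 < q.2.1 ∧ S.eCol q.1 q.2.1 q.2.2.1 q.2.2.2 ≠ none

/-- `d_G(S⟨v⟩)` for a vertex `v` of `S` (junk value `1` on invisible vertices). -/
noncomputable def dVS {r h : ℕ} (Ω : Fin r → Type) [∀ i, Fintype (Ω i)]
    (w : ∀ i, Ω i → ℝ) {K₁ K₂ : Type} (G : CGraph Ω K₁ K₂)
    (S : SComplex r h K₁ K₂) (p : Fin r × Fin h) : ℝ :=
  match S.vCol p.1 p.2 with
  | some c => dV Ω w G p.1 c
  | none => 1

/-- `d_G(S⟨e⟩)` for a size-2 edge `e` of `S` (junk value `1` on invisible edges). -/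
noncomputable def dES {r h : ℕ} (Ω : Fin r → Type) [∀ i, Fintype (Ω i)]
    (w : ∀ i, Ω i → ℝ) {K₁ K₂ : Type} (G : CGraph Ω K₁ K₂)
    (S : SComplex r h K₁ K₂) (q : Fin r × Fin r × Fin h × Fin h) : ℝ :=
  match S.eCol q.1 q.2.1 q.2.2.1 q.2.2.2, S.vCol q.1 q.2.2.1, S.vCol q.2.1 q.2.2.2 with
  | some c₂, some ci, some cj => dE Ω w G q.1 q.2.1 c₂ ci cj
  | _, _, _ => 1

/-- The event `G(φ(v)) = S(v)` for all visible vertices `v` of `S`. -/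
def vEvent {r h : ℕ} {Ω : Fin r → Type} {K₁ K₂ : Type} (G : CGraph Ω K₁ K₂)
    (S : SComplex r h K₁ K₂) (φ : PMap Ω h) : Prop :=
  ∀ p ∈ V1 S, some (G.vCol p.1 (φ p.1 p.2)) = S.vCol p.1 p.2

/-- The event `G(φ(e)) = S(e)` for all visible size-2 edges `e` of `S`. -/
def eEvent {r h : ℕ} {Ω : Fin r → Type} {K₁ K₂ : Type} (G : CGraph Ω K₁ K₂)
    (S : SComplex r h K₁ K₂) (φ : PMap Ω h) : Prop :=
  ∀ q ∈ V2 S, some (G.eCol q.1 q.2.1 (φ q.1 q.2.2.1) (φ q.2.1 q.2.2.2)) =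
    S.eCol q.1 q.2.1 q.2.2.1 q.2.2.2

/-- `P_{φ∈Φ(h)}[G(φ(e)) = S(e) for all e ∈ 𝕍(S)]`. -/
noncomputable def countProb {r h : ℕ} (Ω : Fin r → Type) [∀ i, Fintype (Ω i)]
    (w : ∀ i, Ω i → ℝ) {K₁ K₂ : Type} (G : CGraph Ω K₁ K₂)
    (S : SComplex r h K₁ K₂) : ℝ :=
  EPhi Ω w h fun φ => if vEvent G S φ ∧ eEvent G S φ then 1 else 0

/-- Value of an error function `δ` (defined on index-2 total colors) at `S⟨e⟩`. -/
noncomputable def deltaS {r h : ℕ} {K₁ K₂ : Type} (δ : Fin r → Fin r → K₂ → K₁ → K₁ → ℝ)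
    (S : SComplex r h K₁ K₂) (q : Fin r × Fin r × Fin h × Fin h) : ℝ :=
  match S.eCol q.1 q.2.1 q.2.2.1 q.2.2.2, S.vCol q.1 q.2.2.1, S.vCol q.2.1 q.2.2.2 with
  | some c₂, some ci, some cj => δ q.1 q.2.1 c₂ ci cj
  | _, _, _ => 0

/-- The counting equation (\ref{lj19}) for one complex `S`:
`P[G(φ(e)) = S(e) ∀ e ∈ 𝕍(S)] = ∏_{v∈𝕍₁(S)} d_G(S⟨v⟩) · ∏_{e∈𝕍₂(S)} (d_G(S⟨e⟩) ±̇ δ(S⟨e⟩))`,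
where `a ±̇ b` denotes a suitable number `c` with `max 0 (a-b) ≤ c ≤ min 1 (a+b)`. -/
def CountEqAt {r h : ℕ} (Ω : Fin r → Type) [∀ i, Fintype (Ω i)]
    (w : ∀ i, Ω i → ℝ) {K₁ K₂ : Type} (G : CGraph Ω K₁ K₂)
    (δ : Fin r → Fin r → K₂ → K₁ → K₁ → ℝ) (S : SComplex r h K₁ K₂) : Prop :=
  ∃ c : Fin r × Fin r × Fin h × Fin h → ℝ,
    (∀ q ∈ V2 S, max 0 (dES Ω w G S q - deltaS δ S q) ≤ c q ∧
        c q ≤ min 1 (dES Ω w G S q + deltaS δ S q)) ∧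
    countProb Ω w G S = (∏ p ∈ V1 S, dVS Ω w G S p) * ∏ q ∈ V2 S, c q

/-- `δ` is an `h`-error function of `G`: the counting equation holds for every
`S ∈ S_{h,G}`. -/
def IsErrorFun {r : ℕ} (Ω : Fin r → Type) [∀ i, Fintype (Ω i)]
    (w : ∀ i, Ω i → ℝ) {K₁ K₂ : Type} (G : CGraph Ω K₁ K₂) (h : ℕ)
    (δ : Fin r → Fin r → K₂ → K₁ → K₁ → ℝ) : Prop :=
  ∀ S : SComplex r h K₁ K₂, S.MemS G → CountEqAt Ω w G δ S

/-- `E_{e∈Ω_I}[δ(G⟨e⟩)]` for `I = {i,j}`. -/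
noncomputable def EdgeDeltaAvg {r : ℕ} (Ω : Fin r → Type) [∀ i, Fintype (Ω i)]
    (w : ∀ i, Ω i → ℝ) {K₁ K₂ : Type} (G : CGraph Ω K₁ K₂)
    (δ : Fin r → Fin r → K₂ → K₁ → K₁ → ℝ) (i j : Fin r) : ℝ :=
  ∑ x : Ω i, ∑ y : Ω j,
    w i x * w j y * δ i j (G.eCol i j x y) (G.vCol i x) (G.vCol j y)

/-- `G` is `(ε,h)`-regular. -/
def IsRegularG {r : ℕ} (Ω : Fin r → Type) [∀ i, Fintype (Ω i)]
    (w : ∀ i, Ω i → ℝ) {K₁ K₂ : Type} (G : CGraph Ω K₁ K₂) (h : ℕ) (ε : ℝ) : Prop :=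
  ∃ δ : Fin r → Fin r → K₂ → K₁ → K₁ → ℝ,
    (∀ i j c₂ ci cj, 0 ≤ δ i j c₂ ci cj) ∧
    IsErrorFun Ω w G h δ ∧
    ∀ i j : Fin r, i ≠ j → EdgeDeltaAvg Ω w G δ i j ≤ ε / (G.C2 i j).card

/-- `reg_h(G)`: the minimum `ε` such that `G` is `(ε,h)`-regular. -/
noncomputable def reg {r : ℕ} (Ω : Fin r → Type) [∀ i, Fintype (Ω i)]
    (w : ∀ i, Ω i → ℝ) {K₁ K₂ : Type} (G : CGraph Ω K₁ K₂) (h : ℕ) : ℝ :=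
  sInf {ε : ℝ | IsRegularG Ω w G h ε}

/-- The regularization `G/φ` of `G` by a partitionwise map `φ ∈ Φ(m)`: each vertex
`v ∈ Ω i` is recolored by its original color together with the colors of all edges
joining `v` to the sample points of `φ` in the other parts. Size-2 edges keep
their colors. -/
noncomputable def regz {r : ℕ} (Ω : Fin r → Type) [∀ i, Fintype (Ω i)]
    {K₁ K₂ : Type} [Fintype K₁] [Fintype K₂] (G : CGraph Ω K₁ K₂) {m : ℕ}
    (φ : PMap Ω m) : CGraph Ω (K₁ × (Fin r → Fin m → Option K₂)) K₂ where
  C1 i := univ.filter fun p : K₁ × (Fin r → Fin m → Option K₂) =>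
    p.1 ∈ G.C1 i ∧ ∀ j b, if j = i then p.2 j b = none
      else ∃ c ∈ G.C2 i j, p.2 j b = some c
  C2 := G.C2
  vCol i x := (G.vCol i x, fun j b => if j = i then none else some (G.eCol i j x (φ j b)))
  eCol := G.eCol
  eSymm := G.eSymm
  c2Symm := G.c2Symm
  vMem := by
    intro i x
    simp only [mem_filter, mem_univ, true_and]
    refine ⟨G.vMem i x, fun j b => ?_⟩
    by_cases hj : j = i
    · simp [hj]
    · simp only [hj, if_neg hj]
      exact ⟨G.eCol i j x (φ j b), G.eMem i j x (φ j b), rfl⟩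
  eMem := G.eMem

/-- Conditional expectation of `f` over a random pair `e = (x,y) ∈ Ω_{i} × Ω_{j}`
given the event `A`. -/
noncomputable def condEE {r : ℕ} (Ω : Fin r → Type) [∀ i, Fintype (Ω i)]
    (w : ∀ i, Ω i → ℝ) (i j : Fin r) (A : Ω i → Ω j → Prop) (f : Ω i → Ω j → ℝ) : ℝ :=
  (∑ x : Ω i, ∑ y : Ω j, if A x y then w i x * w j y * f x y else 0) /
  (∑ x : Ω i, ∑ y : Ω j, if A x y then w i x * w j y else 0)

/-- `e ≈_{∂(G/ψ)} e'` : the two pairs have the same frame color in the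
regularization `G/ψ`. -/
def frameRel {r : ℕ} (Ω : Fin r → Type) [∀ i, Fintype (Ω i)]
    {K₁ K₂ : Type} [Fintype K₁] [Fintype K₂] (G : CGraph Ω K₁ K₂) {m : ℕ}
    (ψ : PMap Ω m) (i j : Fin r) (x : Ω i) (y : Ω j) (x' : Ω i) (y' : Ω j) : Prop :=
  (regz Ω G ψ).vCol i x = (regz Ω G ψ).vCol i x' ∧
  (regz Ω G ψ).vCol j y = (regz Ω G ψ).vCol j y'

/-- `η(c₂; ci, cj)` (eq. (\ref{061220})) computed in `G`, with `N` random sample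
vertices in each part (`N = M·h` in the paper). -/
noncomputable def eta {r : ℕ} (Ω : Fin r → Type) [∀ i, Fintype (Ω i)]
    (w : ∀ i, Ω i → ℝ) {K₁ K₂ : Type} [Fintype K₁] [Fintype K₂]
    (G : CGraph Ω K₁ K₂) (N : ℕ) (i j : Fin r) (c₂ : K₂) (ci cj : K₁) : ℝ :=
  EPhi Ω w N fun ψ =>
    condEE Ω w i j (fun x' y' => G.vCol i x' = ci ∧ G.vCol j y' = cj) fun x' y' =>
      (condEE Ω w i j (fun x y => frameRel Ω G ψ i j x y x' y')
          (fun x y => if G.eCol i j x y = c₂ then 1 else 0) -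
        dE Ω w G i j c₂ ci cj) ^ 2

/-- `η(S⟨e⟩)` for a size-2 edge of a complex `S` (junk value `0` if invisible). -/
noncomputable def etaS {r h : ℕ} (Ω : Fin r → Type) [∀ i, Fintype (Ω i)]
    (w : ∀ i, Ω i → ℝ) {K₁ K₂ : Type} [Fintype K₁] [Fintype K₂]
    (G : CGraph Ω K₁ K₂) (N : ℕ) (S : SComplex r h K₁ K₂)
    (q : Fin r × Fin r × Fin h × Fin h) : ℝ :=
  match S.eCol q.1 q.2.1 q.2.2.1 q.2.2.2, S.vCol q.1 q.2.2.1, S.vCol q.2.1 q.2.2.2 with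
  | some c₂, some ci, some cj => eta Ω w G N q.1 q.2.1 c₂ ci cj
  | _, _, _ => 0

/-- `ε₁ := (ε/(6 b₂ binom(r,2)))²`. -/
noncomputable def eps1 (r b₂ : ℕ) (ε : ℝ) : ℝ := (ε / (6 * b₂ * r.choose 2)) ^ 2

/-- `C := √2 · binom(r,2) h² · (b₂/√ε₁)^{binom(r,2)h² − 1}`. -/
noncomputable def Cconst (r h b₂ : ℕ) (ε : ℝ) : ℝ :=
  Real.sqrt 2 * r.choose 2 * h ^ 2 *
    ((b₂ : ℝ) / Real.sqrt (eps1 r b₂ ε)) ^ (r.choose 2 * h ^ 2 - 1)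

/-- `M(m) := (b₁ b₂^{(r−1)m} / √ε₁)^{rh}` (as a sample count). -/
noncomputable def Mconst (r h b₁ b₂ : ℕ) (ε : ℝ) (m : ℕ) : ℕ :=
  ⌈(((b₁ : ℝ) * (b₂ : ℝ) ^ ((r - 1) * m)) / Real.sqrt (eps1 r b₂ ε)) ^ (r * h)⌉₊

/-- A vertex total color `c` of index `{i}` is bad. -/
def BadV {r : ℕ} (Ω : Fin r → Type) [∀ i, Fintype (Ω i)]
    (w : ∀ i, Ω i → ℝ) {K₁ K₂ : Type} (G : CGraph Ω K₁ K₂) (ε₁ : ℝ)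
    (i : Fin r) (c : K₁) : Prop :=
  dV Ω w G i c ≤ Real.sqrt ε₁ / (G.C1 i).card

/-- An index-`{i,j}` total color `(c₂; ci, cj)` is bad: some nonempty `I* ⊆ {i,j}`
has relative density at most `√ε₁/|C_{I*}|`. -/
def BadE {r : ℕ} (Ω : Fin r → Type) [∀ i, Fintype (Ω i)]
    (w : ∀ i, Ω i → ℝ) {K₁ K₂ : Type} (G : CGraph Ω K₁ K₂) (ε₁ : ℝ)
    (i j : Fin r) (c₂ : K₂) (ci cj : K₁) : Prop :=
  BadV Ω w G ε₁ i ci ∨ BadV Ω w G ε₁ j cj ∨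
    dE Ω w G i j c₂ ci cj ≤ Real.sqrt ε₁ / (G.C2 i j).card

/-- The error function `δ` of the paper: `1` on bad total colors, `C·√η` otherwise. -/
noncomputable def deltaDef {r : ℕ} (Ω : Fin r → Type) [∀ i, Fintype (Ω i)]
    (w : ∀ i, Ω i → ℝ) {K₁ K₂ : Type} [Fintype K₁] [Fintype K₂]
    (G : CGraph Ω K₁ K₂) (ε₁ Cc : ℝ) (N : ℕ)
    (i j : Fin r) (c₂ : K₂) (ci cj : K₁) : ℝ :=
  if BadE Ω w G ε₁ i j c₂ ci cj then 1 else Cc * Real.sqrt (eta Ω w G N i j c₂ ci cj)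

/-- `∏_{e∈D}(𝟙[G(φ(e)) = S(e)] − d_G(S⟨e⟩))`, single factor. -/
noncomputable def indMinusD {r h : ℕ} (Ω : Fin r → Type) [∀ i, Fintype (Ω i)]
    (w : ∀ i, Ω i → ℝ) {K₁ K₂ : Type} (G : CGraph Ω K₁ K₂)
    (S : SComplex r h K₁ K₂) (φ : PMap Ω h) (q : Fin r × Fin r × Fin h × Fin h) : ℝ :=
  (if some (G.eCol q.1 q.2.1 (φ q.1 q.2.2.1) (φ q.2.1 q.2.2.2)) =
      S.eCol q.1 q.2.1 q.2.2.1 q.2.2.2 then 1 else 0) - dES Ω w G S q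

/-! ## Helper lemmas -/

/-- Conditional average of `f` on the class of `e` under the labelling `κ`. -/
noncomputable def cAvg {E T : Type*} [Fintype E] (W : E → ℝ) (κ : E → T) (f : E → ℝ) (e : E) : ℝ :=
  (∑ e' : E, if κ e' = κ e then W e' * f e' else 0) / (∑ e' : E, if κ e' = κ e then W e' else 0)

/-- Energy. -/
noncomputable def enrg {E T : Type*} [Fintype E] (W : E → ℝ) (κ : E → T) (f : E → ℝ) : ℝ :=
  ∑ e : E, W e * (cAvg W κ f e) ^ 2

theorem cAvg_mul {E T : Type*} [Fintype E] (W : E → ℝ) (hW : ∀ e, 0 ≤ W e) (κ : E → T)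
    (f g : E → ℝ) (hg : ∀ e e', κ e = κ e' → g e = g e') :
    ∑ e : E, W e * (cAvg W κ f e * g e) = ∑ e : E, W e * (f e * g e) := by
  have h1 : ∀ e, W e * (cAvg W κ f e * g e) =
      ∑ e' : E, if κ e' = κ e then
        W e * (W e' * f e' * g e' / (∑ e'' : E, if κ e'' = κ e' then W e'' else 0)) else 0 := by
    intro e
    unfold cAvg
    rw [Finset.sum_div, Finset.sum_mul, Finset.mul_sum]
    refine Finset.sum_congr rfl fun e' _ => ?_
    split_ifs with hk
    · rw [hg e' e hk, hk]; ring
    · simp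
  rw [Finset.sum_congr rfl fun e _ => h1 e, Finset.sum_comm]
  refine Finset.sum_congr rfl fun e' _ => ?_
  have h2 : (∑ e : E, if κ e' = κ e then
        W e * (W e' * f e' * g e' / (∑ e'' : E, if κ e'' = κ e' then W e'' else 0)) else 0)
      = (∑ e'' : E, if κ e'' = κ e' then W e'' else 0) *
        (W e' * f e' * g e' / (∑ e'' : E, if κ e'' = κ e' then W e'' else 0)) := by
    rw [Finset.sum_mul]
    refine Finset.sum_congr rfl fun e _ => ?_
    by_cases hk : κ e = κ e'
    · rw [if_pos hk, if_pos hk.symm]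
    · rw [if_neg hk, if_neg (Ne.symm hk)]; simp
  rw [h2]
  by_cases hD : (∑ e'' : E, if κ e'' = κ e' then W e'' else 0) = 0
  · have h3 := (Finset.sum_eq_zero_iff_of_nonneg (fun e _ => by
      split_ifs
      · exact hW e
      · exact le_rfl)).1 hD e' (Finset.mem_univ _)
    simp at h3
    simp [h3]
  · field_simp

theorem cAvg_class {E T : Type*} [Fintype E] (W : E → ℝ) (κ : E → T) (f : E → ℝ) (e e' : E)
    (h : κ e = κ e') : cAvg W κ f e = cAvg W κ f e' := by
  unfold cAvg; rw [h]

theorem cAvg_sum {E T : Type*} [Fintype E] (W : E → ℝ) (hW : ∀ e, 0 ≤ W e) (κ : E → T)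
    (f : E → ℝ) : ∑ e : E, W e * cAvg W κ f e = ∑ e : E, W e * f e := by
  simpa using cAvg_mul W hW κ f (fun _ => 1) (fun _ _ _ => rfl)

theorem enrg_diff {E T T' : Type*} [Fintype E] (W : E → ℝ) (hW : ∀ e, 0 ≤ W e) (κ : E → T)
    (κ' : E → T') (hr : ∀ e e', κ e = κ e' → κ' e = κ' e') (f : E → ℝ) :
    ∑ e : E, W e * (cAvg W κ f e - cAvg W κ' f e) ^ 2 = enrg W κ f - enrg W κ' f := by
  have h1 := cAvg_mul W hW κ f (cAvg W κ' f)
    (fun e e' h => cAvg_class W κ' f e e' (hr e e' h))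
  have h2 := cAvg_mul W hW κ' f (cAvg W κ' f) (fun e e' h => cAvg_class W κ' f e e' h)
  unfold enrg
  have h3 : ∑ e : E, W e * (cAvg W κ f e - cAvg W κ' f e) ^ 2 =
      ∑ e : E, W e * (cAvg W κ f e) ^ 2 - 2 * ∑ e : E, W e * (cAvg W κ f e * cAvg W κ' f e)
        + ∑ e : E, W e * (cAvg W κ' f e * cAvg W κ' f e) := by
    rw [Finset.mul_sum, ← Finset.sum_sub_distrib, ← Finset.sum_add_distrib]
    exact Finset.sum_congr rfl fun e _ => by ring
  have h4 : ∑ e : E, W e * (cAvg W κ' f e) ^ 2 = ∑ e : E, W e * (cAvg W κ' f e * cAvg W κ' f e) :=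
    Finset.sum_congr rfl fun e _ => by ring
  rw [h3, h4, h1, h2]; ring

theorem enrg_nonneg {E T : Type*} [Fintype E] (W : E → ℝ) (hW : ∀ e, 0 ≤ W e) (κ : E → T)
    (f : E → ℝ) : 0 ≤ enrg W κ f :=
  Finset.sum_nonneg fun e _ => mul_nonneg (hW e) (sq_nonneg _)

theorem enrg_le {E T : Type*} [Fintype E] (W : E → ℝ) (hW : ∀ e, 0 ≤ W e) (κ : E → T)
    (f : E → ℝ) : enrg W κ f ≤ ∑ e : E, W e * (f e) ^ 2 := by
  have h0 : ∑ e : E, W e * (f e - cAvg W κ f e) ^ 2 =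
      ∑ e : E, W e * (f e) ^ 2 - enrg W κ f := by
    have h2 := cAvg_mul W hW κ f (cAvg W κ f) (fun e e' h => cAvg_class W κ f e e' h)
    have h4 : enrg W κ f = ∑ e : E, W e * (cAvg W κ f e * cAvg W κ f e) :=
      Finset.sum_congr rfl fun e _ => by ring
    have h3 : ∑ e : E, W e * (f e - cAvg W κ f e) ^ 2 =
        ∑ e : E, W e * (f e) ^ 2 - 2 * ∑ e : E, W e * (f e * cAvg W κ f e)
          + ∑ e : E, W e * (cAvg W κ f e * cAvg W κ f e) := by
      rw [Finset.mul_sum, ← Finset.sum_sub_distrib, ← Finset.sum_add_distrib]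
      exact Finset.sum_congr rfl fun e _ => by ring
    rw [h3, h4, h2]; ring
  have : 0 ≤ ∑ e : E, W e * (f e - cAvg W κ f e) ^ 2 :=
    Finset.sum_nonneg fun e _ => mul_nonneg (hW e) (sq_nonneg _)
  linarith

theorem enrg_congr {E T T' : Type*} [Fintype E] (W : E → ℝ) (κ : E → T)
    (κ' : E → T') (hr : ∀ e e', κ e = κ e' ↔ κ' e = κ' e') (f : E → ℝ) :
    enrg W κ f = enrg W κ' f := by
  unfold enrg cAvg
  simp only [hr]

/-! ### expectation over partitionwise maps -/

section EPhiLemmas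

variable {r : ℕ} (Ω : Fin r → Type) [∀ i, Fintype (Ω i)] (w : ∀ i, Ω i → ℝ)

theorem pmapWeight_nonneg (hw : ∀ i x, 0 ≤ w i x) {h : ℕ} (φ : PMap Ω h) :
    0 ≤ pmapWeight Ω w φ :=
  Finset.prod_nonneg fun i _ => Finset.prod_nonneg fun a _ => hw _ _

theorem pmapWeight_sum (htot : ∀ i, ∑ x : Ω i, w i x = 1) (h : ℕ) :
    ∑ φ : PMap Ω h, pmapWeight Ω w φ = 1 := by
  unfold pmapWeight
  rw [← Fintype.prod_sum (fun (i : Fin r) (g : Fin h → Ω i) => ∏ a, w i (g a))]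
  refine Finset.prod_eq_one fun i _ => ?_
  rw [← Fintype.prod_sum (fun (_ : Fin h) (x : Ω i) => w i x)]
  simp [htot]

theorem EPhi_mono (hw : ∀ i x, 0 ≤ w i x) (h : ℕ) (f g : PMap Ω h → ℝ) (hfg : ∀ φ, f φ ≤ g φ) :
    EPhi Ω w h f ≤ EPhi Ω w h g :=
  Finset.sum_le_sum fun φ _ => mul_le_mul_of_nonneg_left (hfg φ) (pmapWeight_nonneg Ω w hw φ)

theorem EPhi_const (htot : ∀ i, ∑ x : Ω i, w i x = 1) (h : ℕ) (c : ℝ) :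
    EPhi Ω w h (fun _ => c) = c := by
  unfold EPhi
  rw [← Finset.sum_mul, pmapWeight_sum Ω w htot, one_mul]

theorem EPhi_add (h : ℕ) (f g : PMap Ω h → ℝ) :
    EPhi Ω w h (fun φ => f φ + g φ) = EPhi Ω w h f + EPhi Ω w h g := by
  unfold EPhi
  rw [← Finset.sum_add_distrib]
  exact Finset.sum_congr rfl fun _ _ => by ring

theorem EPhi_sub (h : ℕ) (f g : PMap Ω h → ℝ) :
    EPhi Ω w h (fun φ => f φ - g φ) = EPhi Ω w h f - EPhi Ω w h g := by
  unfold EPhi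
  rw [← Finset.sum_sub_distrib]
  exact Finset.sum_congr rfl fun _ _ => by ring

theorem EPhi_smul (h : ℕ) (c : ℝ) (f : PMap Ω h → ℝ) :
    EPhi Ω w h (fun φ => c * f φ) = c * EPhi Ω w h f := by
  unfold EPhi
  rw [Finset.mul_sum]
  exact Finset.sum_congr rfl fun _ _ => by ring

theorem EPhi_fsum {ι : Type*} (s : Finset ι) (h : ℕ) (f : ι → PMap Ω h → ℝ) :
    EPhi Ω w h (fun φ => ∑ c ∈ s, f c φ) = ∑ c ∈ s, EPhi Ω w h (f c) := by
  unfold EPhi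
  rw [Finset.sum_comm]
  exact Finset.sum_congr rfl fun _ _ => by rw [Finset.mul_sum]

/-- Concatenation of partitionwise maps. -/
def pAppend {m N : ℕ} (φ : PMap Ω m) (ψ : PMap Ω N) : PMap Ω (m + N) :=
  fun i => Fin.append (φ i) (ψ i)

theorem EPhi_append (m N : ℕ) (F : PMap Ω (m + N) → ℝ) :
    EPhi Ω w (m + N) F = EPhi Ω w m fun φ => EPhi Ω w N fun ψ => F (pAppend Ω φ ψ) := by
  unfold EPhi
  simp only [Finset.mul_sum]
  rw [← Fintype.sum_prod_type']
  symm
  refine Fintype.sum_bijective (fun p : PMap Ω m × PMap Ω N => pAppend Ω p.1 p.2) ?_ _ _ ?_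
  · constructor
    · rintro ⟨a, b⟩ ⟨c, d⟩ hab
      simp only [Prod.mk.injEq]
      constructor
      · funext i x
        have := congrFun (congrFun hab i) (Fin.castAdd N x)
        simpa [pAppend] using this
      · funext i x
        have := congrFun (congrFun hab i) (Fin.natAdd m x)
        simpa [pAppend] using this
    · intro χ
      refine ⟨(fun i x => χ i (Fin.castAdd N x), fun i x => χ i (Fin.natAdd m x)), ?_⟩
      funext i x
      refine Fin.addCases (fun a => ?_) (fun a => ?_) x <;> simp [pAppend]
  · rintro ⟨φ, ψ⟩
    simp only [pmapWeight, pAppend, Fin.prod_univ_add, Fin.append_left, Fin.append_right,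
      Finset.prod_mul_distrib]
    ring

end EPhiLemmas

section GraphLemmas

variable {r : ℕ} (Ω : Fin r → Type) [∀ i, Fintype (Ω i)] (w : ∀ i, Ω i → ℝ)

/-- product weight of a pair -/
def pw (i j : Fin r) (e : Ω i × Ω j) : ℝ := w i e.1 * w j e.2

/-- frame color of a pair -/
def fc {K₁ K₂ : Type} (G : CGraph Ω K₁ K₂) (i j : Fin r) (e : Ω i × Ω j) : K₁ × K₁ :=
  (G.vCol i e.1, G.vCol j e.2)

/-- color indicator -/
noncomputable def cInd {K₁ K₂ : Type} (G : CGraph Ω K₁ K₂) (i j : Fin r) (c : K₂)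
    (e : Ω i × Ω j) : ℝ := if G.eCol i j e.1 e.2 = c then 1 else 0

theorem pw_nonneg (hw : ∀ i x, 0 ≤ w i x) (i j : Fin r) (e : Ω i × Ω j) : 0 ≤ pw Ω w i j e :=
  mul_nonneg (hw _ _) (hw _ _)

theorem pw_sum (htot : ∀ i, ∑ x : Ω i, w i x = 1) (i j : Fin r) :
    ∑ e, pw Ω w i j e = 1 := by
  rw [Fintype.sum_prod_type]
  simp only [pw, ← Finset.mul_sum, htot, mul_one]

theorem condEE_eq {K₁ K₂ : Type} (G : CGraph Ω K₁ K₂) (i j : Fin r) (f : Ω i × Ω j → ℝ)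
    (e : Ω i × Ω j) :
    condEE Ω w i j (fun x y => G.vCol i x = G.vCol i e.1 ∧ G.vCol j y = G.vCol j e.2)
      (fun x y => f (x, y)) = cAvg (pw Ω w i j) (fc Ω G i j) f e := by
  unfold condEE cAvg
  rw [Fintype.sum_prod_type, Fintype.sum_prod_type]
  simp only [fc, Prod.mk.injEq, pw]
  congr!

theorem dE_eq {K₁ K₂ : Type} (G : CGraph Ω K₁ K₂) (i j : Fin r) (c : K₂)
    (e : Ω i × Ω j) :
    dE Ω w G i j c (G.vCol i e.1) (G.vCol j e.2) =
      cAvg (pw Ω w i j) (fc Ω G i j) (cInd Ω G i j c) e := by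
  rw [← condEE_eq]
  unfold dE condEE cInd
  beta_reduce
  congr 1
  · refine Finset.sum_congr rfl fun x _ => Finset.sum_congr rfl fun y _ => ?_
    by_cases h1 : G.eCol i j x y = c <;> simp [h1]
  · congr!

theorem eta_eq {K₁ K₂ : Type} [Fintype K₁] [Fintype K₂] (G : CGraph Ω K₁ K₂) (N : ℕ)
    (i j : Fin r) (c : K₂) (e : Ω i × Ω j) :
    eta Ω w G N i j c (G.vCol i e.1) (G.vCol j e.2) =
      EPhi Ω w N fun ψ => cAvg (pw Ω w i j) (fc Ω G i j) (fun e' =>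
        (cAvg (pw Ω w i j) (fc Ω (regz Ω G ψ) i j) (cInd Ω G i j c) e' -
          cAvg (pw Ω w i j) (fc Ω G i j) (cInd Ω G i j c) e') ^ 2) e := by
  unfold eta
  congr 1
  funext ψ
  rw [← condEE_eq]
  have key : ∀ x y, (G.vCol i x = G.vCol i e.1 ∧ G.vCol j y = G.vCol j e.2) →
      (condEE Ω w i j (fun x₁ y₁ => frameRel Ω G ψ i j x₁ y₁ x y)
          (fun x y => if G.eCol i j x y = c then 1 else 0) -
        dE Ω w G i j c (G.vCol i e.1) (G.vCol j e.2)) ^ 2 =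
      (cAvg (pw Ω w i j) (fc Ω (regz Ω G ψ) i j) (cInd Ω G i j c) (x, y) -
          cAvg (pw Ω w i j) (fc Ω G i j) (cInd Ω G i j c) (x, y)) ^ 2 := by
    intro x y hc
    congr 2
    · rw [← condEE_eq]; rfl
    · rw [dE_eq]
      apply cAvg_class
      simp [fc, hc.1, hc.2]
  rw [condEE, condEE]
  beta_reduce
  congr 1
  refine Finset.sum_congr rfl fun x _ => Finset.sum_congr rfl fun y _ => ?_
  split_ifs with hc
  · rw [key x y hc]
  · rfl

theorem eta_nonneg (hw : ∀ i x, 0 ≤ w i x) {K₁ K₂ : Type} [Fintype K₁] [Fintype K₂]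
    (G : CGraph Ω K₁ K₂) (N : ℕ)
    (i j : Fin r) (c : K₂) (ci cj : K₁) : 0 ≤ eta Ω w G N i j c ci cj := by
  unfold eta EPhi condEE
  refine Finset.sum_nonneg fun ψ _ => mul_nonneg (pmapWeight_nonneg Ω w hw ψ) (div_nonneg ?_ ?_)
  · refine Finset.sum_nonneg fun x _ => Finset.sum_nonneg fun y _ => ?_
    split_ifs
    · exact mul_nonneg (mul_nonneg (hw _ _) (hw _ _)) (sq_nonneg _)
    · exact le_rfl
  · refine Finset.sum_nonneg fun x _ => Finset.sum_nonneg fun y _ => ?_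
    split_ifs
    · exact mul_nonneg (hw _ _) (hw _ _)
    · exact le_rfl

theorem regz_refines {K₁ K₂ : Type} [Fintype K₁] [Fintype K₂] (G : CGraph Ω K₁ K₂) {N : ℕ}
    (ψ : PMap Ω N) (i j : Fin r) (e e' : Ω i × Ω j)
    (h : fc Ω (regz Ω G ψ) i j e = fc Ω (regz Ω G ψ) i j e') : fc Ω G i j e = fc Ω G i j e' := by
  simp only [fc, regz, Prod.mk.injEq] at h ⊢
  exact ⟨h.1.1, h.2.1⟩

theorem regz_vCol_append {K₁ K₂ : Type} [Fintype K₁] [Fintype K₂] (G : CGraph Ω K₁ K₂) {m N : ℕ}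
    (φ : PMap Ω m) (ψ : PMap Ω N) (i : Fin r) (x x' : Ω i) :
    (regz Ω (regz Ω G φ) ψ).vCol i x = (regz Ω (regz Ω G φ) ψ).vCol i x' ↔
    (regz Ω G (pAppend Ω φ ψ)).vCol i x = (regz Ω G (pAppend Ω φ ψ)).vCol i x' := by
  simp only [regz, Prod.mk.injEq, pAppend]
  constructor
  · rintro ⟨⟨h1, h2⟩, h3⟩
    refine ⟨h1, ?_⟩
    funext k b
    refine Fin.addCases (fun a => ?_) (fun a => ?_) b
    · simpa using congrFun (congrFun h2 k) a
    · simpa using congrFun (congrFun h3 k) a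
  · rintro ⟨h1, h2⟩
    refine ⟨⟨h1, ?_⟩, ?_⟩
    · funext k a
      simpa using congrFun (congrFun h2 k) (Fin.castAdd N a)
    · funext k a
      simpa using congrFun (congrFun h2 k) (Fin.natAdd m a)

/-- expected energy -/
noncomputable def Qen {K₁ K₂ : Type} [Fintype K₁] [Fintype K₂] (G : CGraph Ω K₁ K₂)
    (i j : Fin r) (c : K₂) (m : ℕ) : ℝ :=
  EPhi Ω w m fun φ => enrg (pw Ω w i j) (fc Ω (regz Ω G φ) i j) (cInd Ω G i j c)

theorem Qen_diff (hw : ∀ i x, 0 ≤ w i x) (htot : ∀ i, ∑ x : Ω i, w i x = 1)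
    {K₁ K₂ : Type} [Fintype K₁] [Fintype K₂] (G : CGraph Ω K₁ K₂)
    (i j : Fin r) (c : K₂) (m N : ℕ) :
    (EPhi Ω w m fun φ => EPhi Ω w N fun ψ => ∑ e, pw Ω w i j e *
      (cAvg (pw Ω w i j) (fc Ω (regz Ω (regz Ω G φ) ψ) i j) (cInd Ω G i j c) e -
          cAvg (pw Ω w i j) (fc Ω (regz Ω G φ) i j) (cInd Ω G i j c) e) ^ 2) =
    Qen Ω w G i j c (m + N) - Qen Ω w G i j c m := by
  unfold Qen
  rw [EPhi_append, ← EPhi_sub]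
  congr 1
  funext φ
  rw [← EPhi_const Ω w htot N (enrg (pw Ω w i j) (fc Ω (regz Ω G φ) i j) (cInd Ω G i j c)),
    ← EPhi_sub]
  congr 1
  funext ψ
  rw [enrg_diff _ (pw_nonneg Ω w hw i j) _ _ (regz_refines Ω (regz Ω G φ) ψ i j)]
  congr 1
  apply enrg_congr
  intro e e'
  simp only [fc, Prod.mk.injEq, regz_vCol_append]

theorem Qen_mono (hw : ∀ i x, 0 ≤ w i x) (htot : ∀ i, ∑ x : Ω i, w i x = 1)
    {K₁ K₂ : Type} [Fintype K₁] [Fintype K₂] (G : CGraph Ω K₁ K₂)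
    (i j : Fin r) (c : K₂) : Monotone (Qen Ω w G i j c) := by
  intro a b hab
  obtain ⟨N, rfl⟩ := Nat.exists_eq_add_of_le hab
  have h := Qen_diff Ω w hw htot G i j c a N
  have h2 : 0 ≤ Qen Ω w G i j c (a + N) - Qen Ω w G i j c a := by
    rw [← h]
    refine Finset.sum_nonneg fun φ _ => mul_nonneg (pmapWeight_nonneg Ω w hw φ) ?_
    refine Finset.sum_nonneg fun ψ _ => mul_nonneg (pmapWeight_nonneg Ω w hw ψ) ?_
    exact Finset.sum_nonneg fun e _ => mul_nonneg (pw_nonneg Ω w hw i j e) (sq_nonneg _)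
  linarith

theorem Qen_nonneg (hw : ∀ i x, 0 ≤ w i x)
    {K₁ K₂ : Type} [Fintype K₁] [Fintype K₂] (G : CGraph Ω K₁ K₂)
    (i j : Fin r) (c : K₂) (m : ℕ) : 0 ≤ Qen Ω w G i j c m :=
  Finset.sum_nonneg fun φ _ => mul_nonneg (pmapWeight_nonneg Ω w hw φ)
    (enrg_nonneg _ (pw_nonneg Ω w hw i j) _ _)

theorem Qen_sum_le (hw : ∀ i x, 0 ≤ w i x) (htot : ∀ i, ∑ x : Ω i, w i x = 1)
    {K₁ K₂ : Type} [Fintype K₁] [Fintype K₂] (G : CGraph Ω K₁ K₂)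
    (i j : Fin r) (m : ℕ) : ∑ c : K₂, Qen Ω w G i j c m ≤ 1 := by
  unfold Qen
  rw [← EPhi_fsum, ← EPhi_const Ω w htot m 1]
  refine EPhi_mono Ω w hw m _ _ fun φ => ?_
  refine (Finset.sum_le_sum fun c _ => enrg_le _ (pw_nonneg Ω w hw i j) _ _).trans ?_
  rw [Finset.sum_comm, ← pw_sum Ω w htot i j]
  refine Finset.sum_le_sum fun e _ => ?_
  rw [← Finset.mul_sum]
  simp [cInd]

/-- the η average is bounded by an energy increment -/
theorem eta_avg_le (hw : ∀ i x, 0 ≤ w i x) (htot : ∀ i, ∑ x : Ω i, w i x = 1)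
    {K₁ K₂ : Type} [Fintype K₁] [Fintype K₂] (G : CGraph Ω K₁ K₂)
    (i j : Fin r) (m N : ℕ) :
    (EPhi Ω w m fun φ => ∑ e, pw Ω w i j e * eta Ω w (regz Ω G φ) N i j (G.eCol i j e.1 e.2)
      ((regz Ω G φ).vCol i e.1) ((regz Ω G φ).vCol j e.2)) ≤
    ∑ c : K₂, (Qen Ω w G i j c (m + N) - Qen Ω w G i j c m) := by
  simp only [← Qen_diff Ω w hw htot]
  rw [← EPhi_fsum]
  refine EPhi_mono Ω w hw m _ _ fun φ => ?_
  have h1 : ∀ e : Ω i × Ω j,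
      pw Ω w i j e * eta Ω w (regz Ω G φ) N i j (G.eCol i j e.1 e.2)
        ((regz Ω G φ).vCol i e.1) ((regz Ω G φ).vCol j e.2) ≤
      ∑ c : K₂, pw Ω w i j e * eta Ω w (regz Ω G φ) N i j c
        ((regz Ω G φ).vCol i e.1) ((regz Ω G φ).vCol j e.2) := by
    intro e
    exact Finset.single_le_sum (f := fun c => pw Ω w i j e * eta Ω w (regz Ω G φ) N i j c
        ((regz Ω G φ).vCol i e.1) ((regz Ω G φ).vCol j e.2))
      (fun c _ => mul_nonneg (pw_nonneg Ω w hw i j e) (eta_nonneg Ω w hw _ _ _ _ _ _ _))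
      (Finset.mem_univ _)
  refine (Finset.sum_le_sum fun e _ => h1 e).trans ?_
  rw [Finset.sum_comm]
  refine Finset.sum_le_sum fun c _ => le_of_eq ?_
  simp only [eta_eq, ← EPhi_smul]
  rw [← EPhi_fsum]
  congr 1
  funext ψ
  rw [cAvg_sum _ (pw_nonneg Ω w hw i j)]
  rfl

/-! ### bad colors -/

theorem card_mul_le (n : ℕ) (s : ℝ) (hs : 0 ≤ s) : (n : ℝ) * (s / n) ≤ s := by
  by_cases hn : (n : ℝ) = 0
  · simp [hn, hs]
  · rw [mul_div_cancel₀ _ hn]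

theorem badV_le (hw : ∀ i x, 0 ≤ w i x) {K₁ K₂ : Type} (G : CGraph Ω K₁ K₂) (ε₁ : ℝ)
    (i : Fin r) :
    ∑ x : Ω i, w i x * (if BadV Ω w G ε₁ i (G.vCol i x) then 1 else 0) ≤ Real.sqrt ε₁ := by
  have h1 : ∀ x : Ω i, w i x * (if BadV Ω w G ε₁ i (G.vCol i x) then 1 else 0) =
      ∑ c ∈ G.C1 i, if BadV Ω w G ε₁ i c then (if G.vCol i x = c then w i x else 0) else 0 := by
    intro x
    rw [Finset.sum_eq_single (G.vCol i x)]
    · simp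
    · intro c _ hc
      simp [Ne.symm hc]
    · intro hx
      exact absurd (G.vMem i x) hx
  rw [Finset.sum_congr rfl fun x _ => h1 x, Finset.sum_comm]
  have h2 : ∀ c ∈ G.C1 i, (∑ x : Ω i,
      if BadV Ω w G ε₁ i c then (if G.vCol i x = c then w i x else 0) else 0) ≤
      Real.sqrt ε₁ / (G.C1 i).card := by
    intro c _
    by_cases hb : BadV Ω w G ε₁ i c
    · simp only [if_pos hb]
      exact hb
    · simp only [if_neg hb, Finset.sum_const_zero]
      positivity
  refine (Finset.sum_le_sum h2).trans ?_
  rw [Finset.sum_const, nsmul_eq_mul]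
  exact card_mul_le _ _ (Real.sqrt_nonneg _)

theorem badD_le (hw : ∀ i x, 0 ≤ w i x) (htot : ∀ i, ∑ x : Ω i, w i x = 1)
    {K₁ K₂ : Type} (G : CGraph Ω K₁ K₂) (ε₁ : ℝ)
    (i j : Fin r) :
    ∑ e : Ω i × Ω j, pw Ω w i j e * (if dE Ω w G i j (G.eCol i j e.1 e.2) (G.vCol i e.1)
      (G.vCol j e.2) ≤ Real.sqrt ε₁ / (G.C2 i j).card then 1 else 0) ≤ Real.sqrt ε₁ := by
  set τ := Real.sqrt ε₁ / (G.C2 i j).card with hτ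
  have hτ0 : 0 ≤ τ := by positivity
  have h1 : ∀ e : Ω i × Ω j, pw Ω w i j e *
      (if dE Ω w G i j (G.eCol i j e.1 e.2) (G.vCol i e.1) (G.vCol j e.2) ≤ τ then 1 else 0) =
      ∑ c ∈ G.C2 i j, pw Ω w i j e * (cInd Ω G i j c e *
        (if cAvg (pw Ω w i j) (fc Ω G i j) (cInd Ω G i j c) e ≤ τ then 1 else 0)) := by
    intro e
    rw [Finset.sum_eq_single (G.eCol i j e.1 e.2)]
    · simp [cInd, dE_eq]
    · intro c _ hc
      simp [cInd, Ne.symm hc]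
    · intro hx
      exact absurd (G.eMem i j e.1 e.2) hx
  rw [Finset.sum_congr rfl fun e _ => h1 e, Finset.sum_comm]
  have h2 : ∀ c ∈ G.C2 i j, (∑ e, pw Ω w i j e * (cInd Ω G i j c e *
        (if cAvg (pw Ω w i j) (fc Ω G i j) (cInd Ω G i j c) e ≤ τ then 1 else 0))) ≤ τ := by
    intro c _
    rw [← cAvg_mul _ (pw_nonneg Ω w hw i j) (fc Ω G i j)]
    · calc _ ≤ ∑ e, pw Ω w i j e * τ := by
            refine Finset.sum_le_sum fun e _ =>
              mul_le_mul_of_nonneg_left ?_ (pw_nonneg Ω w hw i j e)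
            split_ifs with hc
            · simpa using hc
            · simpa using hτ0
        _ = τ := by rw [← Finset.sum_mul, pw_sum Ω w htot, one_mul]
    · intro e e' he
      rw [cAvg_class _ _ _ e e' he]
  refine (Finset.sum_le_sum h2).trans ?_
  rw [Finset.sum_const, nsmul_eq_mul]
  exact card_mul_le _ _ (Real.sqrt_nonneg _)

theorem badE_le (hw : ∀ i x, 0 ≤ w i x) (htot : ∀ i, ∑ x : Ω i, w i x = 1)
    {K₁ K₂ : Type} (G : CGraph Ω K₁ K₂) (ε₁ : ℝ) (i j : Fin r) :
    ∑ e : Ω i × Ω j, pw Ω w i j e * (if BadE Ω w G ε₁ i j (G.eCol i j e.1 e.2) (G.vCol i e.1)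
      (G.vCol j e.2) then 1 else 0) ≤ 3 * Real.sqrt ε₁ := by
  have hV1 : ∑ e : Ω i × Ω j, pw Ω w i j e *
      (if BadV Ω w G ε₁ i (G.vCol i e.1) then 1 else 0) ≤ Real.sqrt ε₁ := by
    refine le_trans (le_of_eq ?_) (badV_le Ω w hw G ε₁ i)
    rw [Fintype.sum_prod_type]
    refine Finset.sum_congr rfl fun x _ => ?_
    simp only [pw]
    by_cases hB : BadV Ω w G ε₁ i (G.vCol i x)
    · simp only [hB, if_true, mul_one]
      rw [← Finset.mul_sum, htot, mul_one]
    · simp [hB]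
  have hV2 : ∑ e : Ω i × Ω j, pw Ω w i j e *
      (if BadV Ω w G ε₁ j (G.vCol j e.2) then 1 else 0) ≤ Real.sqrt ε₁ := by
    refine le_trans (le_of_eq ?_) (badV_le Ω w hw G ε₁ j)
    rw [Fintype.sum_prod_type, Finset.sum_comm]
    refine Finset.sum_congr rfl fun x _ => ?_
    simp only [pw]
    by_cases hB : BadV Ω w G ε₁ j (G.vCol j x)
    · simp only [hB, if_true, mul_one]
      rw [← Finset.sum_mul, htot, one_mul]
    · simp [hB]
  have hD := badD_le Ω w hw htot G ε₁ i j
  have : 3 * Real.sqrt ε₁ = Real.sqrt ε₁ + Real.sqrt ε₁ + Real.sqrt ε₁ := by ring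
  rw [this]
  refine le_trans ?_ (add_le_add (add_le_add hV1 hV2) hD)
  rw [← Finset.sum_add_distrib, ← Finset.sum_add_distrib]
  refine Finset.sum_le_sum fun e _ => ?_
  rw [← mul_add, ← mul_add]
  refine mul_le_mul_of_nonneg_left ?_ (pw_nonneg Ω w hw i j e)
  unfold BadE
  split_ifs <;> first | (exfalso; tauto) | norm_num

theorem sqrt_le_aux (a t : ℝ) (ha : 0 ≤ a) (ht : 0 < t) : Real.sqrt a ≤ (a / t + t) / 2 := by
  have h1 : a / t = Real.sqrt a ^ 2 / t := by rw [Real.sq_sqrt ha]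
  rw [h1]
  have : 0 ≤ (Real.sqrt a - t) ^ 2 / t := by positivity
  have h2 : (Real.sqrt a - t) ^ 2 / t = Real.sqrt a ^ 2 / t + t - 2 * Real.sqrt a := by
    field_simp
    ring
  linarith

/-- One graph: the δ average is controlled by bad part and the η average. -/
theorem edgeDelta_le (hw : ∀ i x, 0 ≤ w i x) (htot : ∀ i, ∑ x : Ω i, w i x = 1)
    {K₁ K₂ : Type} [Fintype K₁] [Fintype K₂] (G : CGraph Ω K₁ K₂) (ε₁ C t : ℝ) (hC : 0 ≤ C)
    (ht : 0 < t) (N : ℕ) (i j : Fin r) :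
    EdgeDeltaAvg Ω w G (deltaDef Ω w G ε₁ C N) i j ≤
      (3 * Real.sqrt ε₁ + C * t / 2) + C / (2 * t) * ∑ e : Ω i × Ω j, pw Ω w i j e *
        eta Ω w G N i j (G.eCol i j e.1 e.2) (G.vCol i e.1) (G.vCol j e.2) := by
  have hb := badE_le Ω w hw htot G ε₁ i j
  have h1 : EdgeDeltaAvg Ω w G (deltaDef Ω w G ε₁ C N) i j =
      ∑ e : Ω i × Ω j, pw Ω w i j e * deltaDef Ω w G ε₁ C N i j (G.eCol i j e.1 e.2)
        (G.vCol i e.1) (G.vCol j e.2) := by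
    rw [Fintype.sum_prod_type]; rfl
  have h2 : C * t / 2 = ∑ e : Ω i × Ω j, pw Ω w i j e * (C * t / 2) := by
    rw [← Finset.sum_mul, pw_sum Ω w htot, one_mul]
  rw [h1]
  refine le_trans ?_ (add_le_add_left (add_le_add_left hb _) _)
  rw [h2, Finset.mul_sum, ← Finset.sum_add_distrib, ← Finset.sum_add_distrib]
  refine Finset.sum_le_sum fun e _ => ?_
  have h0 := eta_nonneg Ω w hw G N i j (G.eCol i j e.1 e.2) (G.vCol i e.1) (G.vCol j e.2)
  have h3 := sqrt_le_aux _ t h0 ht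
  have hp := pw_nonneg Ω w hw i j e
  rw [mul_left_comm (C / (2 * t)), ← mul_add, ← mul_add]
  refine mul_le_mul_of_nonneg_left ?_ hp
  unfold deltaDef
  split_ifs with hbad
  · have : 0 ≤ C * t / 2 + C / (2 * t) *
      eta Ω w G N i j (G.eCol i j e.1 e.2) (G.vCol i e.1) (G.vCol j e.2) := by positivity
    linarith
  · refine (mul_le_mul_of_nonneg_left h3 hC).trans (le_of_eq ?_)
    field_simp
    ring

end GraphLemmas

/-- eq. (\ref{lj24c}): bounding the average error size. If
`m 0 = 0`, `m (n+1) ≥ m n + M(m n)·h` and `C·b₂·√(b₂/ñ) ≤ ε/(2·binom(r,2))`,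
then for every index pair `I = {i,j}`:
`E_n E_{φ∈Φ(m n)} E_{e∈Ω_I}[δ(G*⟨e⟩)] ≤ ε/(b₂·binom(r,2))`, where `G* = G/φ`
and `δ` is built from `η`, `C` and the bad colors with `M = M(m n)`. -/
theorem delta_average_bound {r : ℕ} (hr : 2 ≤ r) (h b₁ b₂ : ℕ)
    (hh : 1 ≤ h) (hb₁ : 1 ≤ b₁) (hb₂ : 1 ≤ b₂) (ε : ℝ) (hε : 0 < ε)
    (m : ℕ → ℕ) (hm0 : m 0 = 0)
    (hmrec : ∀ n : ℕ, m n + Mconst r h b₁ b₂ ε (m n) * h ≤ m (n + 1))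
    (nt : ℕ) (hnt : 1 ≤ nt)
    (hnt2 : Cconst r h b₂ ε * b₂ * Real.sqrt (b₂ / nt) ≤ ε / (2 * r.choose 2))
    (Ω : Fin r → Type) [∀ i, Fintype (Ω i)] [∀ i, Nonempty (Ω i)]
    (w : ∀ i, Ω i → ℝ) (hw : ∀ i x, 0 ≤ w i x) (htot : ∀ i, ∑ x : Ω i, w i x = 1)
    {K₁ K₂ : Type} [Fintype K₁] [Fintype K₂] (G : CGraph Ω K₁ K₂)
    (hG : G.Bounded b₁ b₂) (i j : Fin r) (hij : i ≠ j) :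
    (1 / nt : ℝ) * ∑ n ∈ Finset.range nt,
        EPhi Ω w (m n) (fun φ =>
          EdgeDeltaAvg Ω w (regz Ω G φ)
            (deltaDef Ω w (regz Ω G φ) (eps1 r b₂ ε) (Cconst r h b₂ ε)
              (Mconst r h b₁ b₂ ε (m n) * h)) i j) ≤
      ε / (b₂ * r.choose 2) := by
  have hntR : (0 : ℝ) < nt := by exact_mod_cast hnt
  have hb2R : (1 : ℝ) ≤ b₂ := by exact_mod_cast hb₂
  have hch : (0 : ℝ) < r.choose 2 := by exact_mod_cast Nat.choose_pos hr
  set t : ℝ := Real.sqrt (b₂ / nt) with htdef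
  have htpos : 0 < t := Real.sqrt_pos.2 (by positivity)
  have htsq : t ^ 2 = b₂ / nt := Real.sq_sqrt (by positivity)
  set C := Cconst r h b₂ ε with hCdef
  have hC : 0 ≤ C := by
    rw [hCdef]; unfold Cconst; positivity
  set ε₁ := eps1 r b₂ ε with hε₁
  have hs : Real.sqrt ε₁ = ε / (6 * b₂ * r.choose 2) := by
    rw [hε₁]; unfold eps1
    exact Real.sqrt_sq (by positivity)
  have hstep : ∀ n ∈ Finset.range nt,
      EPhi Ω w (m n) (fun φ =>
          EdgeDeltaAvg Ω w (regz Ω G φ)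
            (deltaDef Ω w (regz Ω G φ) ε₁ C (Mconst r h b₁ b₂ ε (m n) * h)) i j) ≤
      (3 * Real.sqrt ε₁ + C * t / 2) + C / (2 * t) *
        ((∑ c : K₂, Qen Ω w G i j c (m (n + 1))) - ∑ c : K₂, Qen Ω w G i j c (m n)) := by
    intro n _
    refine (EPhi_mono Ω w hw _ _ _ fun φ =>
      edgeDelta_le Ω w hw htot (regz Ω G φ) ε₁ C t hC htpos _ i j).trans ?_
    rw [EPhi_add, EPhi_const Ω w htot, EPhi_smul]
    have hA := eta_avg_le Ω w hw htot G i j (m n) (Mconst r h b₁ b₂ ε (m n) * h)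
    have hB : ∑ c : K₂, (Qen Ω w G i j c (m n + Mconst r h b₁ b₂ ε (m n) * h) -
        Qen Ω w G i j c (m n)) ≤
        (∑ c : K₂, Qen Ω w G i j c (m (n + 1))) - ∑ c : K₂, Qen Ω w G i j c (m n) := by
      rw [← Finset.sum_sub_distrib]
      refine Finset.sum_le_sum fun c _ => ?_
      have := Qen_mono Ω w hw htot G i j c (hmrec n)
      linarith
    have hC2 : 0 ≤ C / (2 * t) := by positivity
    have := mul_le_mul_of_nonneg_left (hA.trans hB) hC2
    exact add_le_add le_rfl this
  have hsum := Finset.sum_le_sum hstep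
  rw [Finset.sum_add_distrib, ← Finset.mul_sum,
    Finset.sum_range_sub (fun n => ∑ c : K₂, Qen Ω w G i j c (m n)), Finset.sum_const,
    Finset.card_range, nsmul_eq_mul] at hsum
  have hQ1 := Qen_sum_le Ω w hw htot G i j (m nt)
  have hQ0 : 0 ≤ ∑ c : K₂, Qen Ω w G i j c (m 0) :=
    Finset.sum_nonneg fun c _ => Qen_nonneg Ω w hw G i j c (m 0)
  have hC2 : 0 ≤ C / (2 * t) := by positivity
  have hfin : (∑ n ∈ Finset.range nt, EPhi Ω w (m n) (fun φ =>
          EdgeDeltaAvg Ω w (regz Ω G φ)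
            (deltaDef Ω w (regz Ω G φ) ε₁ C (Mconst r h b₁ b₂ ε (m n) * h)) i j)) ≤
      nt * (3 * Real.sqrt ε₁ + C * t / 2) + C / (2 * t) * 1 := by
    refine hsum.trans (add_le_add le_rfl (mul_le_mul_of_nonneg_left ?_ hC2))
    linarith
  have hCt : C * t ≤ ε / (2 * b₂ * r.choose 2) := by
    have : C * t = (C * b₂ * t) / b₂ := by field_simp
    rw [this]
    refine (div_le_div_of_nonneg_right hnt2 (by positivity)).trans (le_of_eq ?_)
    field_simp
  have h5 : (1 / nt : ℝ) * (C / (2 * t) * 1) ≤ C * t / 2 := by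
    have h6 : (1 / nt : ℝ) ≤ t ^ 2 := by
      rw [htsq]; gcongr
    calc (1 / nt : ℝ) * (C / (2 * t) * 1) ≤ t ^ 2 * (C / (2 * t) * 1) := by gcongr
      _ = C * t / 2 := by field_simp
  calc _ ≤ (1 / nt : ℝ) * (nt * (3 * Real.sqrt ε₁ + C * t / 2) + C / (2 * t) * 1) :=
        mul_le_mul_of_nonneg_left hfin (by positivity)
    _ = (3 * Real.sqrt ε₁ + C * t / 2) + (1 / nt : ℝ) * (C / (2 * t) * 1) := by
        field_simp
    _ ≤ 3 * Real.sqrt ε₁ + C * t := by linarith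
    _ ≤ 3 * (ε / (6 * b₂ * r.choose 2)) + ε / (2 * b₂ * r.choose 2) := by
        rw [hs]; linarith
    _ = ε / (b₂ * r.choose 2) := by field_simp; norm_num
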